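/- arXiv:1906.05072 — 3 statements merged into one kernel-verified Lean document; each statement's English description precedes it below -/
import Mathlib

section
/- Let k be an algebraically closed field and A a finitely generated k-algebra which is an integral domain. Then the group A^× / k^× of units of A modulo constants is a finitely generated free abelian group. -/
open IsDedekindDomain in
/-- A Dedekind domain that is integral over a local domain has only finitely many nonzero primes. -/
theorem IsDedekindDomain.HeightOneSpectrum.finite_of_isIntegral (O B : Type*) [CommRing O] [IsDomain O]
    [IsLocalRing O] [CommRing B] [IsDedekindDomain B] [Algebra O B]
    [Module.IsTorsionFree O B] [Algebra.IsIntegral O B] : Finite (HeightOneSpectrum B) := by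
  have hfin := IsDedekindDomain.primesOver_finite (IsLocalRing.maximalIdeal O) B
  have := hfin.to_subtype
  refine Finite.of_injective (β := (IsLocalRing.maximalIdeal O).primesOver B)
    (fun v ↦ ⟨v.asIdeal, v.isPrime, ⟨?_⟩⟩) fun v w h ↦ HeightOneSpectrum.ext (congrArg Subtype.val h)
  have := v.isMaximal
  exact (IsLocalRing.eq_maximalIdeal (Ideal.IsMaximal.under O v.asIdeal)).symm

open IsDedekindDomain WithZero in
/-- Integrality over a local Dedekind domain, in a finite separable extension of its fraction
field, is detected by finitely many discrete valuations. -/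
theorem exists_units_hom_isIntegral_of_isSeparable (O F L : Type*) [CommRing O] [IsDedekindDomain O]
    [IsLocalRing O] [Field F] [Algebra O F] [IsFractionRing O F] [Field L] [Algebra F L]
    [Algebra O L] [IsScalarTower O F L] [FiniteDimensional F L] [Algebra.IsSeparable F L] :
    ∃ (n : ℕ) (f : Lˣ →* (Fin n → Multiplicative ℤ)),
      ∀ u : Lˣ, f u = 1 → IsIntegral O (u : L) := by
  have := integralClosure.isDedekindDomain O F L
  have : IsFractionRing (integralClosure O L) L :=
    integralClosure.isFractionRing_of_finite_extension F L
  have : FaithfulSMul O L := by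
    rw [faithfulSMul_iff_algebraMap_injective, IsScalarTower.algebraMap_eq O F L]
    exact (algebraMap F L).injective.comp (IsFractionRing.injective O F)
  have := HeightOneSpectrum.finite_of_isIntegral O (integralClosure O L)
  obtain ⟨n, ⟨e⟩⟩ := Finite.exists_equiv_fin (HeightOneSpectrum (integralClosure O L))
  refine ⟨n, MonoidHom.pi fun i ↦ (unitsWithZeroEquiv (α := Multiplicative ℤ)).toMonoidHom.comp
    (Units.map ((e.symm i).valuation L : L →* _)), fun u hu ↦ ?_⟩
  obtain ⟨y, hy⟩ := HeightOneSpectrum.mem_integers_of_valuation_le_one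
    (R := integralClosure O L) L (u : L) fun v ↦ by
      have h : unitsWithZeroEquiv (α := Multiplicative ℤ)
          (Units.map ((e.symm (e v)).valuation L : L →* _) u) = 1 :=
        congrFun hu (e v)
      rw [map_eq_one_iff _ unitsWithZeroEquiv.injective, Equiv.symm_apply_apply] at h
      exact (congrArg Units.val h).le
  exact hy ▸ y.2

/-- Integrality over a local Dedekind domain, in a finite extension of its fraction field, is
detected by finitely many discrete valuations. -/
theorem exists_units_hom_isIntegral (O F K : Type*) [CommRing O] [IsDedekindDomain O]
    [IsLocalRing O] [Field F] [Algebra O F] [IsFractionRing O F] [Field K] [Algebra F K]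
    [Algebra O K] [IsScalarTower O F K] [FiniteDimensional F K] :
    ∃ (n : ℕ) (f : Kˣ →* (Fin n → Multiplicative ℤ)),
      ∀ u : Kˣ, f u = 1 → IsIntegral O (u : K) := by
  let L := separableClosure F K
  obtain ⟨n, f, hf⟩ := exists_units_hom_isIntegral_of_isSeparable O F L
  have : IsScalarTower O L K := .of_algebraMap_eq fun _ ↦ rfl
  let φ := IsPurelyInseparable.iterateFrobenius L K (ringExpChar L) le_rfl
  refine ⟨n, f.comp (Units.map φ.toMonoidHom), fun u hu ↦ ?_⟩
  have h := (hf _ hu).algebraMap (B := K)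
  have hφ : algebraMap L K (φ u) = (u : K) ^ _ :=
    IsPurelyInseparable.algebraMap_iterateFrobenius L (ringExpChar L) le_rfl (u : K)
  exact IsIntegral.of_pow (pow_pos (expChar_pos L (ringExpChar L)) _) (hφ ▸ h)

open MonoidWithZeroHom in
/-- The valuation subring of a valuation with cyclic, possibly trivial, value group is a principal
ideal ring. -/
theorem Valuation.isPrincipalIdealRing_valuationSubring_of_isCyclic {F Γ : Type*} [Field F]
    [LinearOrderedCommGroupWithZero Γ] (v : Valuation F Γ) [IsCyclic (valueGroup (.ofClass v))] :
    IsPrincipalIdealRing v.valuationSubring := by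
  rcases subsingleton_or_nontrivial (valueGroup (.ofClass v)) with h | h
  · have hone (x : F) (hx : x ≠ 0) : v x = 1 :=
      congrArg (fun y : valueGroup (.ofClass v) ↦ (y : Γˣ).val) (Subsingleton.elim
        (⟨Units.mk0 (v x) (v.ne_zero_iff.mpr hx), mem_valueGroup _ ⟨x, rfl⟩⟩ :
          valueGroup (.ofClass v)) 1)
    refine IsField.isPrincipalIdealRing ⟨⟨0, 1, zero_ne_one⟩, mul_comm, fun {a} ha ↦ ?_⟩
    have ha' : (a : F) ≠ 0 := fun h ↦ ha (Subtype.ext h)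
    exact ⟨⟨(a : F)⁻¹, (hone _ (inv_ne_zero ha')).le⟩, Subtype.ext (mul_inv_cancel₀ ha')⟩
  · exact v.valuationSubring_isPrincipalIdealRing

open WithZero in
/-- The valuation on a polynomial ring over a field given by the total degree. -/
noncomputable def MvPolynomial.degreeValuation (σ k : Type*) [Field k] :
    Valuation (MvPolynomial σ k) (WithZero (Multiplicative ℤ)) where
  toFun p := by classical exact if p = 0 then 0 else exp (p.totalDegree : ℤ)
  map_zero' := by simp
  map_one' := by simp
  map_mul' p q := by
    by_cases hp : p = 0
    · simp [hp]
    by_cases hq : q = 0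
    · simp [hq]
    simp [hp, hq, totalDegree_mul_of_isDomain hp hq, exp_add]
  map_add_le_max' p q := by
    by_cases hp : p = 0
    · rw [hp, zero_add]
      exact le_max_right _ _
    by_cases hq : q = 0
    · rw [hq, add_zero]
      exact le_max_left _ _
    by_cases hpq : p + q = 0
    · simp [hpq]
    have h := totalDegree_add p q
    simp only [hp, hq, hpq, if_false, le_max_iff, exp_le_exp, Nat.cast_le]
    exact le_max_iff.mp h

theorem MvPolynomial.degreeValuation_apply {σ k : Type*} [Field k] {p : MvPolynomial σ k}
    (hp : p ≠ 0) : degreeValuation σ k p = WithZero.exp (p.totalDegree : ℤ) := by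
  simp [degreeValuation, hp]

theorem MvPolynomial.mem_range_C_of_degreeValuation_le_one {σ k : Type*} [Field k]
    {p : MvPolynomial σ k} (hp : degreeValuation σ k p ≤ 1) : p ∈ (C : k →+* _).range := by
  by_cases h0 : p = 0
  · exact h0 ▸ zero_mem _
  rw [degreeValuation_apply h0, ← WithZero.exp_zero, WithZero.exp_le_exp] at hp
  exact ⟨_, (totalDegree_eq_zero_iff_eq_C.mp (by omega)).symm⟩

theorem MvPolynomial.nonZeroDivisors_le_primeCompl_supp (σ k : Type*) [Field k] :
    nonZeroDivisors (MvPolynomial σ k) ≤ (degreeValuation σ k).supp.primeCompl := by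
  intro p hp hp'
  have h0 := nonZeroDivisors.ne_zero hp
  have : degreeValuation σ k p = 0 := hp'
  simp [degreeValuation_apply h0] at this

/-- If the coefficients of the minimal polynomial of `x` come from an algebraically closed subfield
`k` of the base, then `x` lies in `k`. -/
theorem mem_range_of_minpoly_mem_lifts {k F K : Type*} [Field k] [IsAlgClosed k] [Field F]
    [Field K] [Algebra k F] [Algebra F K] [Algebra k K] [IsScalarTower k F K] {x : K}
    (hx : IsIntegral F x) (h : ∀ n, (minpoly F x).coeff n ∈ (algebraMap k F).range) :
    x ∈ (algebraMap k K).range := by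
  obtain ⟨q, hq, hdeg, hmonic⟩ := Polynomial.lifts_and_natDegree_eq_and_monic
    ((Polynomial.lifts_iff_coeff_lifts _).mpr h) (minpoly.monic hx)
  have hint : IsIntegral k x := ⟨q, hmonic, by
    rw [IsScalarTower.algebraMap_eq k F K, ← Polynomial.eval₂_map, hq]
    exact minpoly.aeval F x⟩
  exact minpoly.mem_range_of_degree_eq_one k x
    (IsAlgClosed.degree_eq_one_of_irreducible k (minpoly.irreducible hint))

theorem Subgroup.exists_mulEquiv_fin_int {n : ℕ} (H : Subgroup (Fin n → Multiplicative ℤ)) :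
    ∃ m : ℕ, Nonempty (H ≃* Multiplicative (Fin m → ℤ)) := by
  let e : (Fin n → Multiplicative ℤ) ≃* Multiplicative (Fin n → ℤ) :=
    (MulEquiv.piMultiplicative _).symm
  let S : Submodule ℤ (Fin n → ℤ) :=
    AddSubgroup.toIntSubmodule (Subgroup.toAddSubgroup' (H.map e.toMonoidHom))
  obtain ⟨m, b⟩ := Submodule.basisOfPid (Pi.basisFun ℤ (Fin n)) S
  exact ⟨m, ⟨(H.equivMapOfInjective e.toMonoidHom e.injective).trans
    (AddEquiv.toMultiplicative b.equivFun.toAddEquiv)⟩⟩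

/-- The units of `A` admit a homomorphism to a finite power of `ℤ` with kernel inside `kˣ`. -/
theorem exists_units_hom_ker_le_range (k A : Type*) [Field k] [IsAlgClosed k] [CommRing A]
    [IsDomain A] [Algebra k A] [Algebra.FiniteType k A] :
    ∃ (n : ℕ) (f : Aˣ →* (Fin n → Multiplicative ℤ)),
      ∀ u : Aˣ, f u = 1 → (u : A) ∈ (algebraMap k A).range := by
  obtain ⟨s, g, hg, hfin⟩ := exists_finite_inj_algHom_of_fg k A
  let P := MvPolynomial (Fin s) k
  let F := FractionRing P
  let K := FractionRing A
  algebraize [g.toRingHom]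
  have : IsScalarTower k P A := .of_algebraMap_eq fun x ↦ (g.commutes x).symm
  have : FaithfulSMul P A := (faithfulSMul_iff_algebraMap_injective P A).mpr hg
  let := FractionRing.liftAlgebra P K
  have : Module.Finite P A := hfin
  have : FiniteDimensional F K := inferInstanceAs (FiniteDimensional (FractionRing P) _)
  have : IsScalarTower k P K := .to₁₂₄ k P A K
  have : IsScalarTower k F K := .to₁₃₄ k P F K
  let v := (MvPolynomial.degreeValuation (Fin s) k).extendToLocalization
    (MvPolynomial.nonZeroDivisors_le_primeCompl_supp _ _) F
  let O := v.valuationSubring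
  have : IsPrincipalIdealRing O := v.isPrincipalIdealRing_valuationSubring_of_isCyclic
  let : Algebra O K := ((algebraMap F K).comp (algebraMap O F)).toAlgebra
  have : IsScalarTower O F K := .of_algebraMap_eq fun _ ↦ rfl
  obtain ⟨n, f, hf⟩ := exists_units_hom_isIntegral O F K
  refine ⟨n, f.comp (Units.map (algebraMap A K).toMonoidHom), fun u hu ↦ ?_⟩
  have hO : IsIntegral O (algebraMap A K u) := hf _ hu
  have hP : IsIntegral P (algebraMap A K u) := (Algebra.IsIntegral.isIntegral (u : A)).algebraMap
  obtain ⟨c, hc⟩ := mem_range_of_minpoly_mem_lifts (k := k) (F := F) hP.tower_top fun m ↦ by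
    have h₁ := congrArg (Polynomial.coeff · m) (minpoly.isIntegrallyClosed_eq_field_fractions' F hO)
    have h₂ := congrArg (Polynomial.coeff · m) (minpoly.isIntegrallyClosed_eq_field_fractions' F hP)
    simp only [Polynomial.coeff_map] at h₁ h₂
    obtain ⟨c, hc⟩ := MvPolynomial.mem_range_C_of_degreeValuation_le_one
      (p := (minpoly P (algebraMap A K u)).coeff m) (by
        rw [← Valuation.extendToLocalization_apply_map_apply _
          (MvPolynomial.nonZeroDivisors_le_primeCompl_supp _ _) F, ← h₂, h₁]
        exact ((minpoly O (algebraMap A K u)).coeff m).2)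
    refine ⟨c, ?_⟩
    rw [h₂, ← hc, IsScalarTower.algebraMap_apply k P F]
    rfl
  exact ⟨c, IsFractionRing.injective A K (by rw [← hc, IsScalarTower.algebraMap_apply k A K])⟩

/-- Every homomorphism from the units of an algebraically closed field to a finite power of `ℤ` is
trivial. -/
theorem IsAlgClosed.units_monoidHom_pi_int_eq_one {k : Type*} [Field k] [IsAlgClosed k] {n : ℕ}
    (f : kˣ →* (Fin n → Multiplicative ℤ)) : f = 1 := by
  ext c i
  let a : ℤ := (f c i).toAdd
  obtain ⟨d, hd⟩ := IsAlgClosed.exists_pow_nat_eq (c : k) (Nat.succ_pos a.natAbs)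
  have hd0 : d ≠ 0 := by
    rintro rfl
    exact c.ne_zero (by rw [← hd, zero_pow (Nat.succ_ne_zero _)])
  have hc : c = Units.mk0 d hd0 ^ (a.natAbs + 1) := Units.ext hd.symm
  have ha : a = (a.natAbs + 1 : ℕ) * (f (Units.mk0 d hd0) i).toAdd := by
    conv_lhs => rw [show a = (f c i).toAdd from rfl, hc]
    rw [map_pow, Pi.pow_apply, toAdd_pow, nsmul_eq_mul]
  have : a = 0 := Int.eq_zero_of_abs_lt_dvd ⟨_, ha⟩ (by rw [Int.abs_eq_natAbs]; omega)
  exact this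

/-- **Rosenlicht's units lemma.** Let `k` be an algebraically closed field and
`A` a finitely generated `k`-algebra which is an integral domain.  Then the
group `Aˣ/kˣ` of units of `A` modulo nonzero constants is a finitely generated
free abelian group, i.e. isomorphic to `ℤⁿ` for some `n`. -/
theorem rosenlicht_units_modulo_constants
    (k A : Type*) [Field k] [IsAlgClosed k] [CommRing A] [IsDomain A]
    [Algebra k A] [Algebra.FiniteType k A] :
    ∃ n : ℕ, Nonempty
      ((Aˣ ⧸ (Units.map (algebraMap k A : k →+* A).toMonoidHom).range) ≃*
        Multiplicative (Fin n → ℤ)) := by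
  obtain ⟨n, f, hf⟩ := exists_units_hom_ker_le_range k A
  have hker : (Units.map (algebraMap k A : k →+* A).toMonoidHom).range = f.ker := by
    ext u
    constructor
    · rintro ⟨c, rfl⟩
      exact DFunLike.congr_fun (IsAlgClosed.units_monoidHom_pi_int_eq_one
        (f.comp (Units.map (algebraMap k A : k →+* A).toMonoidHom))) c
    · intro hu
      obtain ⟨c, hc⟩ := hf u hu
      have hc0 : c ≠ 0 := by
        rintro rfl
        exact u.ne_zero (by rw [← hc, map_zero])
      exact ⟨Units.mk0 c hc0, Units.ext hc⟩
  obtain ⟨m, ⟨e⟩⟩ := f.range.exists_mulEquiv_fin_int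
  exact ⟨m, ⟨((QuotientGroup.quotientMulEquivOfEq hker).trans
    (QuotientGroup.quotientKerEquivRange f)).trans e⟩⟩
end

section
/- Let S be a separated noetherian scheme and U ⊆ S a nonempty dense open subscheme. Then the set of open subschemes V of S with U ⊆ V such that the inclusion V → S is an affine morphism is finite and has a smallest element under inclusion. -/
open AlgebraicGeometry

universe u

section Algebra

open IsLocalRing

theorem Submodule.exists_pow_smul_eq_pow_succ_smul {A M : Type*} [CommRing A] [AddCommGroup M]
    [Module A M] (f : A) [IsArtinian A (torsionBy A M f)] (hf : ∀ x : M, ∃ k : ℕ, f ^ k • x = 0) :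
    ∃ n : ℕ, ∀ x : M, ∃ y : M, f ^ n • x = f ^ (n + 1) • y := by
  let c : ℕ →o (Submodule A (torsionBy A M f))ᵒᵈ :=
    { toFun n := OrderDual.toDual
        ((LinearMap.range (LinearMap.lsmul A M (f ^ n))).comap (torsionBy A M f).subtype)
      monotone' := by
        refine monotone_nat_of_le_succ fun n ↦ ?_
        rintro x ⟨y, hy⟩
        exact ⟨f • y, by simpa [pow_succ, mul_smul, smul_comm f] using hy⟩ }
  obtain ⟨n, hn⟩ := IsArtinian.monotone_stabilizes c
  refine ⟨n, ?_⟩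
  have key (k : ℕ) : ∀ x : M, f ^ (k + n) • x = 0 → ∃ y : M, f ^ n • x = f ^ (n + 1) • y := by
    induction k with
    | zero => exact fun x hx ↦ ⟨0, by simpa using hx⟩
    | succ k ih =>
      intro x hx
      have hmem : f ^ (k + n) • x ∈ torsionBy A M f := by
        rw [mem_torsionBy_iff, smul_smul, ← pow_succ', ← hx]
        ring_nf
      have h1 : (⟨_, hmem⟩ : torsionBy A M f) ∈ OrderDual.ofDual (c (n + k)) :=
        ⟨x, by simp [add_comm]⟩
      rw [← hn (n + k) (by lia), hn (n + k + 1) (by lia)] at h1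
      obtain ⟨y, hy⟩ := h1
      replace hy : f ^ (n + k + 1) • y = f ^ (k + n) • x := hy
      obtain ⟨z, hz⟩ := ih (x - f • y) (by
        rw [smul_sub, ← hy, smul_smul, ← pow_succ, sub_eq_zero]; ring_nf)
      refine ⟨y + z, ?_⟩
      rw [smul_add, ← hz, smul_sub, smul_smul, ← pow_succ]
      abel
  intro x
  obtain ⟨k, hk⟩ := hf x
  exact key k x (by rw [add_comm, pow_add, mul_smul, hk, smul_zero])

theorem Ideal.exists_pow_le_annihilator {A N : Type*} [CommRing A] [IsNoetherianRing A]
    [AddCommGroup N] [Module A N] [Module.Finite A N] (I : Ideal A)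
    (h : ∀ g ∈ I, ∀ x : N, ∃ k : ℕ, g ^ k • x = 0) :
    ∃ k : ℕ, I ^ k ≤ Module.annihilator A N := by
  refine Ideal.exists_pow_le_of_le_radical_of_fg (fun g hg ↦ ?_) (IsNoetherian.noetherian I)
  obtain ⟨s, hs⟩ := Module.Finite.fg_top (R := A) (M := N)
  choose k hk using h g hg
  refine ⟨s.sup k, Module.mem_annihilator.mpr fun x ↦ ?_⟩
  have hx : x ∈ Submodule.span A (s : Set N) := hs ▸ Submodule.mem_top
  induction hx using Submodule.span_induction with
  | mem x hx =>
    obtain ⟨l, hl⟩ := Nat.exists_eq_add_of_le (Finset.le_sup (f := k) hx)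
    rw [hl, add_comm, pow_add, mul_smul, hk, smul_zero]
  | zero => simp
  | add x y _ _ hx hy => rw [smul_add, hx, hy, add_zero]
  | smul a x _ hx => rw [smul_comm, hx, smul_zero]

theorem IsLocalRing.isArtinian_of_maximalIdeal_pow_le_annihilator {A N : Type*} [CommRing A]
    [IsNoetherianRing A] [IsLocalRing A] [AddCommGroup N] [Module A N] [Module.Finite A N] {k : ℕ}
    (h : maximalIdeal A ^ k ≤ Module.annihilator A N) : IsArtinian A N := by
  have : IsArtinianRing (A ⧸ maximalIdeal A ^ k) := by
    have : Ring.KrullDimLE 0 (A ⧸ maximalIdeal A ^ k) := by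
      refine Ring.KrullDimLE.mk₀ fun P hP ↦ ?_
      have hm : maximalIdeal A ≤ P.comap (Ideal.Quotient.mk _) :=
        Ideal.IsPrime.le_of_pow_le (n := k) fun x hx ↦ by
          rw [Ideal.mem_comap, Ideal.Quotient.eq_zero_iff_mem.mpr hx]
          exact P.zero_mem
      have : (P.comap (Ideal.Quotient.mk (maximalIdeal A ^ k))).IsMaximal := by
        rw [← (maximalIdeal.isMaximal A).eq_of_le Ideal.IsPrime.ne_top' hm]
        infer_instance
      exact Ideal.isMaximal_of_isIntegral_of_isMaximal_comap (R := A) P this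
    exact IsNoetherianRing.isArtinianRing_of_krullDimLE_zero
  have ht : Module.IsTorsionBySet A N (maximalIdeal A ^ k : Ideal A) := fun x a ↦
    Module.mem_annihilator.mp (h a.2) x
  let := ht.module
  have : IsScalarTower A (A ⧸ maximalIdeal A ^ k) N := ht.isScalarTower
  have : Module.Finite (A ⧸ maximalIdeal A ^ k) N := Module.Finite.of_restrictScalars_finite A _ _
  exact isArtinian_of_surjective_algebraMap (S := A) (R := A ⧸ maximalIdeal A ^ k)
    Ideal.Quotient.mk_surjective

theorem IsLocalRing.exists_maximalIdeal_pow_smul_subset {A M : Type*} [CommRing A]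
    [IsNoetherianRing A] [IsLocalRing A] [AddCommGroup M] [Module A M] {f : A}
    (hf : f ∈ maximalIdeal A) (h : ∀ g ∈ maximalIdeal A, ∀ x : M, ∃ k : ℕ, g ^ k • x = 0)
    (hfin : ∀ n : ℕ, Module.Finite A (Submodule.torsionBy A M (f ^ n))) :
    ∃ k : ℕ, ∀ g ∈ maximalIdeal A ^ k, ∀ x : M, ∃ y : M, g • x = f • y := by
  have hk (n : ℕ) := Ideal.exists_pow_le_annihilator (N := Submodule.torsionBy A M (f ^ n))
    (maximalIdeal A) (fun g hg x ↦ (h g hg x).imp fun k hk ↦ Subtype.ext hk)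
  have : IsArtinian A (Submodule.torsionBy A M f) := by
    have := hfin 1
    obtain ⟨k, hk⟩ := hk 1
    rw [pow_one] at *
    exact isArtinian_of_maximalIdeal_pow_le_annihilator hk
  obtain ⟨n, hn⟩ := Submodule.exists_pow_smul_eq_pow_succ_smul f (h f hf)
  obtain ⟨k, hk⟩ := hk n
  refine ⟨k, fun g hg x ↦ ?_⟩
  obtain ⟨y, hy⟩ := hn x
  have hz : x - f • y ∈ Submodule.torsionBy A M (f ^ n) := by
    rw [Submodule.mem_torsionBy_iff, smul_sub, hy, smul_smul, ← pow_succ, sub_self]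
  have := congrArg Subtype.val (Module.mem_annihilator.mp (hk hg) ⟨_, hz⟩)
  refine ⟨g • y, ?_⟩
  rwa [Submodule.coe_smul, smul_sub, Submodule.coe_zero, sub_eq_zero, smul_comm] at this

theorem Submodule.finite_torsionBy_quotient_range {A B : Type*} [CommRing A] [IsNoetherianRing A]
    [CommRing B] [Algebra A B] {f : A} (hf : algebraMap A B f ∈ nonZeroDivisors B) :
    Module.Finite A
      (torsionBy A (B ⧸ LinearMap.range (Algebra.linearMap A B)) f) := by
  let R := LinearMap.range (Algebra.linearMap A B)
  let N : Submodule A B := R.comap (LinearMap.lsmul A B f)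
  have : IsNoetherian A R := inferInstance
  have : IsNoetherian A N := isNoetherian_of_injective
    (((LinearMap.lsmul A B f).restrict (p := N) (q := R) fun x hx ↦ hx)) (by
      intro x y hxy
      have := congrArg Subtype.val hxy
      simp only [LinearMap.coe_restrict_apply, LinearMap.lsmul_apply, Algebra.smul_def] at this
      exact Subtype.ext ((mul_cancel_left_mem_nonZeroDivisors hf).mp this))
  have hle : torsionBy A (B ⧸ R) f ≤ N.map R.mkQ := by
    intro x hx
    obtain ⟨b, rfl⟩ := R.mkQ_surjective x
    refine ⟨b, ?_, rfl⟩
    rw [mem_torsionBy_iff, ← map_smul] at hx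
    exact (Submodule.Quotient.mk_eq_zero R).mp hx
  have : IsNoetherian A (N.map R.mkQ) := inferInstance
  have := isNoetherian_of_le hle
  infer_instance

/-- Algebraic form of: if the punctured spectrum of a noetherian local ring is affine,
then that ring has dimension at most one. -/
theorem IsLocalRing.maximalIdeal_le_radical_span_singleton {A B : Type*} [CommRing A]
    [IsNoetherianRing A] [IsLocalRing A] [CommRing B] [Algebra A B]
    (hinj : Function.Injective (algebraMap A B)) {f : A} (hf : f ∈ maximalIdeal A)
    (hfB : algebraMap A B f ∈ nonZeroDivisors B)
    (hpow : ∀ g ∈ maximalIdeal A, ∀ b : B, ∃ (n : ℕ) (a : A), g ^ n • b = algebraMap A B a)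
    (htop : (maximalIdeal A).map (algebraMap A B) = ⊤) :
    maximalIdeal A ≤ (Ideal.span {f}).radical := by
  let R := LinearMap.range (Algebra.linearMap A B)
  obtain ⟨k, hk⟩ := exists_maximalIdeal_pow_smul_subset (M := B ⧸ R) hf (by
    intro g hg x
    obtain ⟨b, rfl⟩ := R.mkQ_surjective x
    obtain ⟨n, a, h⟩ := hpow g hg b
    refine ⟨n, ?_⟩
    rw [← map_smul]
    exact (Submodule.Quotient.mk_eq_zero R).mpr ⟨a, h.symm⟩)
    (fun n ↦ Submodule.finite_torsionBy_quotient_range (by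
      rw [map_pow]; exact pow_mem hfB n))
  have hdecomp (b : B) : ∃ a c, b = algebraMap A B a + f • c := by
    suffices h : ∀ x ∈ (maximalIdeal A ^ k).map (algebraMap A B), ∀ b : B,
        ∃ a c, b * x = algebraMap A B a + f • c by
      simpa using h 1 (by rw [Ideal.map_pow, htop, Ideal.top_pow]; trivial) b
    intro x hx
    induction hx using Submodule.span_induction with
    | mem x hx =>
      obtain ⟨g, hg, rfl⟩ := hx
      intro b
      obtain ⟨y, hy⟩ := hk g hg (R.mkQ b)
      obtain ⟨c, rfl⟩ := R.mkQ_surjective y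
      rw [← map_smul, ← map_smul, ← sub_eq_zero, ← map_sub] at hy
      obtain ⟨a, ha⟩ := (Submodule.Quotient.mk_eq_zero R).mp hy
      refine ⟨a, c, ?_⟩
      rw [Algebra.linearMap_apply] at ha
      rw [ha, Algebra.smul_def g]
      ring
    | zero => exact fun b ↦ ⟨0, 0, by simp⟩
    | add x y _ _ hx hy =>
      intro b
      obtain ⟨a, c, h⟩ := hx b
      obtain ⟨a', c', h'⟩ := hy b
      exact ⟨a + a', c + c', by rw [mul_add, h, h', map_add, smul_add]; abel⟩
    | smul b' x _ hx => exact fun b ↦ by simpa [mul_assoc] using hx (b * b')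
  have hone : ∀ x ∈ (maximalIdeal A).map (algebraMap A B),
      ∃ a ∈ maximalIdeal A, ∃ c, x = algebraMap A B a + f • c := by
    intro x hx
    induction hx using Submodule.span_induction with
    | mem x hx =>
      obtain ⟨g, hg, rfl⟩ := hx
      exact ⟨g, hg, 0, by simp⟩
    | zero => exact ⟨0, zero_mem _, 0, by simp⟩
    | add x y _ _ hx hy =>
      obtain ⟨a, ha, c, h⟩ := hx
      obtain ⟨a', ha', c', h'⟩ := hy
      exact ⟨a + a', add_mem ha ha', c + c', by rw [h, h', map_add, smul_add]; abel⟩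
    | smul b x _ hx =>
      obtain ⟨a, ha, c, rfl⟩ := hx
      obtain ⟨a', c', rfl⟩ := hdecomp b
      refine ⟨a' * a, Ideal.mul_mem_left _ _ ha,
        algebraMap A B a' * c + c' * (algebraMap A B a + f • c), ?_⟩
      rw [smul_eq_mul, map_mul]
      simp only [Algebra.smul_def f]
      ring
  obtain ⟨a, ha, c, hc⟩ := hone 1 (htop ▸ Submodule.mem_top)
  obtain ⟨u, hu⟩ : IsUnit (1 - a) := by
    by_contra h
    exact (maximalIdeal.isMaximal A).ne_top
      ((Ideal.eq_top_iff_one _).mpr (by simpa using add_mem ((mem_maximalIdeal _).mpr h) ha))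
  have hinv : algebraMap A B f * (algebraMap A B ↑u⁻¹ * c) = 1 := by
    rw [Algebra.smul_def] at hc
    calc _ = algebraMap A B ↑u⁻¹ * (1 - algebraMap A B a) := by rw [hc]; ring
      _ = algebraMap A B (↑u⁻¹ * ↑u) := by rw [hu]; simp
      _ = 1 := by simp
  intro g hg
  obtain ⟨n, a', h⟩ := hpow g hg (algebraMap A B ↑u⁻¹ * c)
  refine ⟨n, Ideal.mem_span_singleton.mpr ⟨a', hinj ?_⟩⟩
  rw [map_mul, ← h, Algebra.smul_def, mul_left_comm, hinv, mul_one]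

end Algebra

section Topology

variable {α : Type*} [TopologicalSpace α]

theorem exists_mem_genericPoints_specializes [QuasiSober α] (z : α) :
    ∃ x ∈ genericPoints α, x ⤳ z :=
  let x := genericPoints.ofComponent ⟨_, irreducibleComponent_mem_irreducibleComponents z⟩
  ⟨x, x.2, (genericPoints.isGenericPoint_ofComponent _).specializes mem_irreducibleComponent⟩

theorem eq_of_specializes_of_mem_genericPoints [T0Space α] {x y : α} (hx : x ∈ genericPoints α)
    (h : y ⤳ x) : y = x :=
  (h.antisymm (specializes_iff_closure_subset.mpr
    (hx.2 (isIrreducible_singleton (x := y)).closure h.closure_subset))).eq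

theorem exists_finite_forall_exists_specializes [TopologicalSpace.NoetherianSpace α]
    [QuasiSober α] [T0Space α] : ∃ G : Set α, G.Finite ∧ ∀ z, ∃ g ∈ G, g ⤳ z :=
  ⟨genericPoints α, genericPoints.finite
    TopologicalSpace.NoetherianSpace.finite_irreducibleComponents,
    exists_mem_genericPoints_specializes⟩

theorem Dense.exists_specializes [TopologicalSpace.NoetherianSpace α] [QuasiSober α] [T0Space α]
    {U : Set α} (hU : IsOpen U) (hd : Dense U) (z : α) : ∃ x ∈ U, x ⤳ z := by
  have := hU.isOpenEmbedding_subtypeVal.quasiSober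
  obtain ⟨G, hG, h⟩ := exists_finite_forall_exists_specializes (α := U)
  have hcl : IsClosed (⋃ g ∈ G, closure {(g : α)}) := hG.isClosed_biUnion fun _ _ ↦ isClosed_closure
  have hle : U ⊆ ⋃ g ∈ G, closure {(g : α)} := fun x hx ↦ by
    obtain ⟨g, hg, hgx⟩ := h ⟨x, hx⟩
    exact Set.mem_biUnion hg ((subtype_specializes_iff _ _).mp hgx).mem_closure
  obtain ⟨g, hg, hgz⟩ := Set.mem_iUnion₂.mp (hcl.closure_subset_iff.mpr hle (hd z))
  exact ⟨g, g.2, specializes_iff_mem_closure.mpr hgz⟩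

end Topology

namespace AlgebraicGeometry

open CategoryTheory IsLocalRing

theorem isAffineHom_ι_preimage {X Y : Scheme.{u}} (f : X ⟶ Y) (V : Y.Opens) [IsAffineHom V.ι] :
    IsAffineHom (f ⁻¹ᵁ V).ι :=
  MorphismProperty.of_isPullback (isPullback_morphismRestrict f V) ‹_›

theorem isAffineHom_ι_inf {X : Scheme.{u}} (V W : X.Opens) [IsAffineHom V.ι] [IsAffineHom W.ι] :
    IsAffineHom (V ⊓ W).ι := by
  have := isAffineHom_ι_preimage V.ι W
  have hrange : Set.range (V ⊓ W).ι = Set.range ((V.ι ⁻¹ᵁ W).ι ≫ V.ι) := by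
    have := congrArg SetLike.coe (V.ι.image_preimage_eq_opensRange_inf W)
    rw [Scheme.Opens.opensRange_ι] at this
    rw [Scheme.Hom.comp_base, TopCat.coe_comp, Set.range_comp, Scheme.Opens.range_ι,
      Scheme.Opens.range_ι]
    exact this.symm
  rw [← IsOpenImmersion.isoOfRangeEq_hom_fac (V ⊓ W).ι ((V.ι ⁻¹ᵁ W).ι ≫ V.ι) hrange]
  infer_instance

/-- If the punctured spectrum of a noetherian local domain is affine,
then all its points are generic. -/
theorem asIdeal_eq_bot_of_isAffineOpen_compl_closedPoint {A : CommRingCat.{u}} [IsDomain A]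
    [IsNoetherianRing A] [IsLocalRing A] {V : (Spec A).Opens} (hV : IsAffineOpen V)
    (h : ∀ x : Spec A, x ∈ V ↔ x ≠ closedPoint A) {q : Spec A} (hq : q ≠ closedPoint A) :
    q.asIdeal = ⊥ := by
  by_contra hbot
  obtain ⟨f, hfq, hf0⟩ := Submodule.exists_mem_ne_zero_of_ne_bot hbot
  have hfm : f ∈ maximalIdeal A := le_maximalIdeal q.2.ne_top hfq
  have hne : Nonempty V := ⟨⟨q, (h q).mpr hq⟩⟩
  let D (g : A) : (Spec A).Opens := PrimeSpectrum.basicOpen g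
  have hD (g : A) (hg : g ∈ maximalIdeal A) : D g ≤ V := by
    intro x hx
    refine (h x).mpr ?_
    rintro rfl
    exact hx hg
  have hres (W : (Spec A).Opens) (hW : W ≤ V) (a : A) :
      (Spec A).presheaf.map (homOfLE hW).op (algebraMap A Γ(Spec A, V) a) =
        algebraMap A Γ(Spec A, W) a := by
    simp only [IsAffineOpen.algebraMap_Spec_obj, ← CommRingCat.comp_apply, Category.assoc,
      ← Functor.map_comp]
    rfl
  have hloc (g : A) : IsLocalization.Away g Γ(Spec A, D g) :=
    StructureSheaf.IsLocalization.to_basicOpen _ g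
  have hinj : Function.Injective (algebraMap A Γ(Spec A, V)) := by
    intro a b hab
    exact (ConcreteCategory.bijective_of_isIso (Scheme.ΓSpecIso A).inv).1
      (map_injective_of_isIntegral (Spec A) (homOfLE (le_top : V ≤ ⊤)) hab)
  have hrad := maximalIdeal_le_radical_span_singleton hinj hfm
    (mem_nonZeroDivisors_of_ne_zero ((map_ne_zero_iff _ hinj).mpr hf0)) (by
      intro g hg b
      by_cases hg0 : g = 0
      · exact ⟨1, 0, by simp [hg0]⟩
      have : Nonempty (D g) := ⟨⟨⟨⊥, Ideal.isPrime_bot⟩, fun h ↦ hg0 h⟩⟩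
      obtain ⟨⟨a, _, n, rfl⟩, ha⟩ := IsLocalization.surj (S := Γ(Spec A, D g)) (Submonoid.powers g)
        ((Spec A).presheaf.map (homOfLE (hD g hg)).op b)
      refine ⟨n, a, map_injective_of_isIntegral (Spec A) (homOfLE (hD g hg)) ?_⟩
      rw [hres, ← ha, Algebra.smul_def, map_mul, hres, mul_comm]) (by
      rw [Ideal.map, ← hV.self_le_iSup_basicOpen_iff]
      intro x hx
      obtain ⟨g, hg, hgx⟩ : ∃ g ∈ maximalIdeal A, g ∉ (x : PrimeSpectrum A).asIdeal := by
        by_contra! hle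
        exact (h x).mp hx (PrimeSpectrum.ext
          ((maximalIdeal.isMaximal A).eq_of_le x.2.ne_top hle).symm)
      refine TopologicalSpace.Opens.mem_iSup.mpr ⟨⟨_, g, hg, rfl⟩, ?_⟩
      change x ∈ (Spec A).basicOpen
        ((Spec A).presheaf.map (homOfLE (le_top : V ≤ ⊤)).op ((Scheme.ΓSpecIso A).inv g))
      rw [Scheme.basicOpen_res, basicOpen_eq_of_affine]
      exact ⟨hx, hgx⟩)
  have hle : maximalIdeal A ≤ q.asIdeal := hrad.trans
    (q.2.radical_le_iff.mpr ((Ideal.span_singleton_le_iff_mem _).mpr hfq))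
  exact hq (PrimeSpectrum.ext ((maximalIdeal.isMaximal A).eq_of_le q.2.ne_top hle).symm)

/-- The complement of an open subscheme with affine inclusion has codimension at most one. -/
theorem Scheme.Opens.eq_or_eq_of_specializes_of_isAffineHom {S : Scheme.{u}}
    [IsLocallyNoetherian S] (V : S.Opens) [IsAffineHom V.ι] {x y z : S} (hx : x ∉ V)
    (hV : ∀ w, w ⤳ x → w ≠ x → w ∈ V) (hzy : z ⤳ y) (hyx : y ⤳ x) : y = z ∨ y = x := by
  obtain ⟨p, hp⟩ : ∃ p : PrimeSpectrum (S.presheaf.stalk x), S.fromSpecStalk x p = y :=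
    (S.range_fromSpecStalk (x := x)).ge hyx
  obtain ⟨r, hr⟩ : ∃ r : PrimeSpectrum (S.presheaf.stalk x), S.fromSpecStalk x r = z :=
    (S.range_fromSpecStalk (x := x)).ge (hzy.trans hyx)
  have hrp : r.asIdeal ≤ p.asIdeal := by
    refine (PrimeSpectrum.le_iff_specializes r p).mpr ?_
    refine (S.fromSpecStalk x).isEmbedding.specializes_iff.mp ?_
    rw [← hp, ← hr] at hzy
    exact hzy
  let A := CommRingCat.of (S.presheaf.stalk x ⧸ r.asIdeal)
  let i : Spec A ⟶ Spec (S.presheaf.stalk x) :=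
    Spec.map (CommRingCat.ofHom (Ideal.Quotient.mk r.asIdeal))
  have : IsNoetherianRing A := inferInstanceAs (IsNoetherianRing (_ ⧸ r.asIdeal))
  have : IsDomain A := inferInstanceAs (IsDomain (_ ⧸ r.asIdeal))
  have : IsLocalRing A := IsLocalRing.of_surjective' (Ideal.Quotient.mk r.asIdeal)
    Ideal.Quotient.mk_surjective
  have : IsLocalHom (Ideal.Quotient.mk r.asIdeal) :=
    IsLocalHom.of_surjective _ Ideal.Quotient.mk_surjective
  have : IsClosedImmersion i := IsClosedImmersion.spec_of_surjective _ Ideal.Quotient.mk_surjective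
  let φ := i ≫ S.fromSpecStalk x
  have hφ : Function.Injective φ := φ.isEmbedding.injective
  have hclosed : φ (closedPoint A) = x := by
    refine (Scheme.Hom.comp_apply _ _ _).trans ?_
    refine Eq.trans (congrArg _ ?_) Scheme.fromSpecStalk_closedPoint
    exact comap_closedPoint (Ideal.Quotient.mk r.asIdeal)
  have := isAffineHom_ι_preimage φ V
  have haff : IsAffineOpen (φ ⁻¹ᵁ V) := isAffine_of_isAffineHom (φ ⁻¹ᵁ V).ι
  have hmem (w : Spec A) : w ∈ φ ⁻¹ᵁ V ↔ w ≠ closedPoint A := by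
    constructor
    · rintro h rfl
      exact hx (hclosed ▸ h)
    · intro h
      refine hV _ ?_ (hclosed ▸ hφ.ne h)
      have := (specializes_closedPoint w).map φ.continuous
      rwa [hclosed] at this
  obtain ⟨q, rfl⟩ : ∃ q, i q = p := by
    have : p ∈ Set.range (PrimeSpectrum.comap (Ideal.Quotient.mk r.asIdeal)) := by
      rw [range_comap_of_surjective _ _ Ideal.Quotient.mk_surjective, Ideal.mk_ker]
      exact hrp
    exact this
  by_cases hq : q = closedPoint A
  · right
    rw [← hclosed, ← hp, hq]
    rfl
  · left
    have hbot := asIdeal_eq_bot_of_isAffineOpen_compl_closedPoint haff hmem hq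
    rw [← hp, ← hr]
    congr 1
    apply PrimeSpectrum.ext
    change q.asIdeal.comap (Ideal.Quotient.mk r.asIdeal) = _
    rw [hbot, ← RingHom.ker_eq_comap_bot, Ideal.mk_ker]

theorem Scheme.Opens.finite_setOf_le_and_isAffineHom_ι {S : Scheme.{u}} [IsNoetherian S]
    {U : S.Opens} (hU : Dense (U : Set S)) : {V : S.Opens | U ≤ V ∧ IsAffineHom V.ι}.Finite := by
  have sober (V : S.Opens) : QuasiSober ((V : Set S)ᶜ : Set S) :=
    V.isOpen.isClosed_compl.isClosedEmbedding_subtypeVal.quasiSober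
  obtain ⟨G, hG, hGU⟩ := exists_finite_forall_exists_specializes (α := ((U : Set S)ᶜ : Set S))
  refine Set.Finite.of_finite_image (f := fun V : S.Opens ↦ {g ∈ G | g.1 ∈ V})
    (hG.finite_subsets.subset ?_) ?_
  · rintro _ ⟨V, -, rfl⟩
    exact Set.sep_subset _ _
  have key (V : S.Opens) (hV : U ≤ V ∧ IsAffineHom V.ι) (z : S) (hz : z ∉ V) :
      ∃ g ∈ G, g.1 ∉ V ∧ g.1 ⤳ z := by
    have := hV.2
    obtain ⟨x, hx, hxz⟩ :=
      exists_mem_genericPoints_specializes (α := ((V : Set S)ᶜ : Set S)) ⟨z, hz⟩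
    obtain ⟨y, hy, hyx⟩ := hGU ⟨x, fun h ↦ x.2 (hV.1 h)⟩
    rw [subtype_specializes_iff] at hxz hyx
    obtain ⟨w, hw, hwy⟩ := hU.exists_specializes U.isOpen y.1
    have := V.eq_or_eq_of_specializes_of_isAffineHom x.2 (fun w hw hne ↦ by
      by_contra hwV
      exact hne (congrArg Subtype.val (eq_of_specializes_of_mem_genericPoints (y := ⟨w, hwV⟩) hx
        ((subtype_specializes_iff _ _).mpr hw)))) hwy hyx
    obtain h | h := this
    · exact absurd (h ▸ hw) y.2
    · exact ⟨y, hy, h ▸ x.2, hyx.trans hxz⟩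
  have hle (V W : S.Opens) (hV : U ≤ V ∧ IsAffineHom V.ι)
      (h : {g ∈ G | g.1 ∈ V} = {g ∈ G | g.1 ∈ W}) : W ≤ V := by
    intro z hzW
    by_contra hzV
    obtain ⟨g, hg, hgV, hgz⟩ := key V hV z hzV
    exact hgV (h.ge ⟨hg, hgz.mem_open W.isOpen hzW⟩).2
  exact fun V hV W hW h ↦ le_antisymm (hle W V hW h.symm) (hle V W hV h)

end AlgebraicGeometry

/-- Let `S` be a separated noetherian scheme and `U ⊆ S` a nonempty dense open
subscheme.  Then the set of open subschemes `V ⊇ U` whose inclusion `V → S` is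
an affine morphism is finite and has a smallest element under inclusion. -/
theorem finite_and_exists_min_affine_opens_containing_dense_open
    (S : Scheme.{u}) [S.IsSeparated] [IsNoetherian S]
    (U : S.Opens) (hne : (U : Set S) ≠ ∅) (hdense : Dense (U : Set S)) :
    {V : S.Opens | U ≤ V ∧ IsAffineHom V.ι}.Finite ∧
      ∃ V₀ ∈ {V : S.Opens | U ≤ V ∧ IsAffineHom V.ι},
        ∀ V ∈ {V : S.Opens | U ≤ V ∧ IsAffineHom V.ι}, V₀ ≤ V := by
  have hfin := Scheme.Opens.finite_setOf_le_and_isAffineHom_ι hdense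
  refine ⟨hfin, ?_⟩
  obtain ⟨V₀, hV₀⟩ := hfin.exists_minimal ⟨⊤, le_top, by
    rw [← Scheme.topIso_hom]; infer_instance⟩
  refine ⟨V₀, hV₀.prop, fun V hV ↦ ?_⟩
  have := hV.2
  have := hV₀.prop.2
  exact (hV₀.le_of_le ⟨le_inf hV₀.prop.1 hV.1, isAffineHom_ι_inf V₀ V⟩ inf_le_left).trans
    inf_le_right
end

section
/- Let R = F_p[[u]] and A = R[x, y, (x−y)^{-1}]/(xy − u). Then the preperfection A^{p^∞/R} = lim_i A^{p^i/R} (limit along relative Frobenius maps) is equal to R, i.e., the natural map R → A^{p^∞/R} is an isomorphism. -/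
open TensorProduct

set_option maxHeartbeats 1000000
set_option synthInstance.maxHeartbeats 400000

universe u

/-- `Tw p i R` is `R`, viewed as an `R`-algebra via the `i`-th iterate of the
absolute Frobenius `x ↦ x^p`. -/
def Tw (p i : ℕ) (R : Type u) : Type u := R

variable (p i : ℕ) (R : Type u)

instance [CommRing R] : CommRing (Tw p i R) := inferInstanceAs (CommRing R)

/-- The identity of `R`, as a ring isomorphism `R ≃+* Tw p i R`. -/
def twCast [CommRing R] : R ≃+* Tw p i R := RingEquiv.refl R

noncomputable instance [CommRing R] [Fact p.Prime] [CharP R p] : Algebra R (Tw p i R) :=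
  ((twCast p i R).toRingHom.comp (iterateFrobenius R p i)).toAlgebra

lemma tw_algebraMap_apply [CommRing R] [Fact p.Prime] [CharP R p] (r : R) :
    algebraMap R (Tw p i R) r = twCast p i R (r ^ p ^ i) := rfl

lemma tw_smul_def [CommRing R] [Fact p.Prime] [CharP R p] (r : R) (x : Tw p i R) :
    r • x = twCast p i R (r ^ p ^ i) * x := Algebra.smul_def r x

variable (A : Type u)

/-- The `i`-th Frobenius twist `A^{p^i/R} = A ⊗_{R, Frob^i} R` of an `R`-algebra `A`,
viewed as an `R`-algebra via the right-hand tensor factor. -/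
def FTw [CommRing R] [CommRing A] [Algebra R A] [Fact p.Prime] [CharP R p] : Type u :=
  A ⊗[R] (Tw p i R)

section
variable [CommRing R] [CommRing A] [Algebra R A] [Fact p.Prime] [CharP R p]

noncomputable instance : CommRing (FTw p i R A) :=
  inferInstanceAs (CommRing (A ⊗[R] Tw p i R))

noncomputable instance : Algebra R (FTw p i R A) :=
  ((Algebra.TensorProduct.includeRight (R := R) (A := A) (B := Tw p i R)).toRingHom.comp
    (twCast p i R).toRingHom).toAlgebra

lemma ftw_algebraMap_apply (r : R) :
    algebraMap R (FTw p i R A) r = (1 : A) ⊗ₜ[R] (twCast p i R r) := rfl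

end

section
variable [CommRing R] [CommRing A] [Algebra R A] [Fact p.Prime] [CharP R p] [CharP A p]

/-- The relative Frobenius `A^{p^{i+1}/R} → A^{p^i/R}`, `a ⊗ r ↦ a^p ⊗ r`,
as an additive map. -/
noncomputable def transAddHom : (A ⊗[R] Tw p (i + 1) R) →+ (A ⊗[R] Tw p i R) :=
  TensorProduct.liftAddHom
    { toFun := fun a =>
        { toFun := fun v => (a ^ p) ⊗ₜ[R] (twCast p i R ((twCast p (i + 1) R).symm v))
          map_zero' := by simp
          map_add' := by intro v w; simp [TensorProduct.tmul_add] }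
      map_zero' := by
        ext v
        simp [zero_pow (Nat.Prime.ne_zero Fact.out)]
      map_add' := by
        intro a b
        ext v
        simp [add_pow_char, TensorProduct.add_tmul] }
    (by
      intro r a v
      simp only [AddMonoidHom.coe_mk, ZeroHom.coe_mk]
      rw [smul_pow, TensorProduct.smul_tmul]
      congr 1
      rw [tw_smul_def, tw_smul_def, map_mul, RingEquiv.symm_apply_apply, ← map_mul]
      congr 2
      rw [← pow_mul, ← pow_succ'])

@[simp] lemma transAddHom_tmul (a : A) (v : Tw p (i + 1) R) :
    transAddHom p i R A (a ⊗ₜ[R] v) =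
      (a ^ p) ⊗ₜ[R] (twCast p i R ((twCast p (i + 1) R).symm v)) :=
  TensorProduct.liftAddHom_tmul _ _ _ _

/-- The relative Frobenius `A^{p^{i+1}/R} → A^{p^i/R}` as a ring homomorphism. -/
noncomputable def transRingHom : (A ⊗[R] Tw p (i + 1) R) →+* (A ⊗[R] Tw p i R) :=
  { transAddHom p i R A with
    map_one' := by
      show transAddHom p i R A ((1 : A) ⊗ₜ[R] (1 : Tw p (i+1) R)) = (1 : A ⊗[R] Tw p i R)
      rw [transAddHom_tmul, one_pow]
      simp [Algebra.TensorProduct.one_def]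
    map_mul' := by
      intro x y
      show transAddHom p i R A (x * y) = transAddHom p i R A x * transAddHom p i R A y
      induction x using TensorProduct.induction_on with
      | zero => simp
      | tmul a v =>
        induction y using TensorProduct.induction_on with
        | zero => simp
        | tmul b w =>
          rw [Algebra.TensorProduct.tmul_mul_tmul, transAddHom_tmul, transAddHom_tmul,
            transAddHom_tmul, Algebra.TensorProduct.tmul_mul_tmul, mul_pow, map_mul, map_mul]
        | add y₁ y₂ h₁ h₂ => rw [mul_add, map_add, h₁, h₂, map_add, mul_add]
      | add x₁ x₂ h₁ h₂ => rw [add_mul, map_add, h₁, h₂, map_add, add_mul] }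

/-- The relative Frobenius `A^{p^{i+1}/R} → A^{p^i/R}` as an `R`-algebra
homomorphism (for the `R`-algebra structures through the right-hand factors). -/
noncomputable def transAlgHom : FTw p (i + 1) R A →ₐ[R] FTw p i R A :=
  { transRingHom p i R A with
    commutes' := by
      intro r
      show transAddHom p i R A ((1 : A) ⊗ₜ[R] (twCast p (i+1) R r)) =
        (1 : A) ⊗ₜ[R] (twCast p i R r)
      simp }

@[simp] lemma transAlgHom_apply (x : FTw p (i + 1) R A) :
    transAlgHom p i R A x = transAddHom p i R A x := rfl

/-- The preperfection `A^{p^∞/R} = lim_i A^{p^i/R}`, the inverse limit of the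
Frobenius twists of `A` along the relative Frobenius maps, as an `R`-subalgebra
of the product `Π i, A^{p^i/R}`. -/
noncomputable def prePerfection : Subalgebra R (∀ i, FTw p i R A) where
  carrier := {x | ∀ i, transAlgHom p i R A (x (i + 1)) = x i}
  add_mem' := by
    intro x y hx hy i
    simp only [Pi.add_apply, map_add, hx i, hy i]
  mul_mem' := by
    intro x y hx hy i
    simp only [Pi.mul_apply, map_mul, hx i, hy i]
  algebraMap_mem' := by
    intro r i
    show transAlgHom p i R A (algebraMap R (FTw p (i+1) R A) r) = _
    rw [AlgHom.commutes]
    rfl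

variable (M : Type u) [AddCommGroup M] [Module R M]

/-- The inverse limit `lim_i (A^{p^i/R} ⊗_R M)` of the modules obtained by
tensoring the Frobenius twists of `A` with an `R`-module `M`, as a submodule
of the product. -/
noncomputable def limTensor : Submodule R (∀ i, (FTw p i R A) ⊗[R] M) where
  carrier := {x | ∀ i,
    LinearMap.rTensor M (transAlgHom p i R A).toLinearMap (x (i + 1)) = x i}
  add_mem' := by
    intro x y hx hy i
    simp only [Pi.add_apply, map_add, hx i, hy i]
  zero_mem' := by
    intro i
    simp only [Pi.zero_apply, map_zero]
  smul_mem' := by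
    intro r x hx i
    simp only [Pi.smul_apply, map_smul, hx i]

/-- The natural base change map `(lim_i A^{p^i/R}) ⊗_R M → lim_i (A^{p^i/R} ⊗_R M)`
(viewed as a map into the product `Π i, A^{p^i/R} ⊗_R M`; its image lies in the
inverse limit `limTensor`). -/
noncomputable def basechange :
    (↥(prePerfection p R A) ⊗[R] M) →ₗ[R] ∀ i, (FTw p i R A) ⊗[R] M :=
  LinearMap.pi fun i =>
    TensorProduct.map ((LinearMap.proj i).comp (prePerfection p R A).val.toLinearMap)
      LinearMap.id

end

section RelFrobenius

variable (B : Type u) [CommRing R] [Fact p.Prime] [CharP R p]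
  [CommRing B] [Algebra R B] [CharP B p]

/-- The relative Frobenius `B^{p/R} = B ⊗_{R, Frob} R → B`, `b ⊗ r ↦ b^p · r`,
as an additive map. -/
noncomputable def relFrobenius : (B ⊗[R] Tw p 1 R) →+ B :=
  TensorProduct.liftAddHom
    { toFun := fun b =>
        { toFun := fun v => algebraMap R B ((twCast p 1 R).symm v) * b ^ p
          map_zero' := by simp
          map_add' := by intro v w; simp [add_mul]
        }
      map_zero' := by
        ext v
        simp [zero_pow (Nat.Prime.ne_zero Fact.out)]
      map_add' := by
        intro a b
        ext v
        simp [add_pow_char, mul_add] }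
    (by
      intro r b v
      simp only [AddMonoidHom.coe_mk, ZeroHom.coe_mk]
      rw [smul_pow, tw_smul_def, map_mul, RingEquiv.symm_apply_apply, map_mul,
        Algebra.smul_def, map_pow, pow_one]
      rw [map_pow]
      ring)

@[simp] lemma relFrobenius_tmul (b : B) (v : Tw p 1 R) :
    relFrobenius p R B (b ⊗ₜ[R] v) = algebraMap R B ((twCast p 1 R).symm v) * b ^ p :=
  TensorProduct.liftAddHom_tmul _ _ _ _

end RelFrobenius


/-- `R = F_p[[u]]`. -/
noncomputable abbrev R14 (p : ℕ) : Type := PowerSeries (ZMod p)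

/-- The ideal `(xy - u, z·(x-y) - 1)` of `R[x,y,z]`: dividing out by it
imposes the relation `xy = u` and inverts `x - y`. -/
noncomputable abbrev I14 (p : ℕ) : Ideal (MvPolynomial (Fin 3) (R14 p)) :=
  Ideal.span {MvPolynomial.X 0 * MvPolynomial.X 1 - MvPolynomial.C PowerSeries.X,
    MvPolynomial.X 2 * (MvPolynomial.X 0 - MvPolynomial.X 1) - 1}

/-- `A = R[x,y,(x-y)⁻¹]/(xy - u)`. -/
noncomputable abbrev A14 (p : ℕ) : Type := MvPolynomial (Fin 3) (R14 p) ⧸ I14 p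

section NodalDegeneration

open HahnSeries

/-- The ring endomorphism `X ↦ X ^ q` of the ring of Laurent series. -/
noncomputable def laurentExpand (R : Type*) [CommRing R] (q : ℕ) (hq : 0 < q) :
    LaurentSeries R →+* LaurentSeries R :=
  embDomainRingHom (AddMonoidHom.mulLeft (q : ℤ))
    (mul_right_injective₀ (by exact_mod_cast hq.ne'))
    (fun _ _ => mul_le_mul_iff_right₀ (by exact_mod_cast hq))

variable {p i R A}

lemma laurentExpand_single [CommRing R] {q : ℕ} (hq : 0 < q) (k : ℤ) (r : R) :
    laurentExpand R q hq (single k r) = single (q * k) r :=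
  embDomain_single

lemma coeff_laurentExpand_of_not_dvd [CommRing R] {q : ℕ} (hq : 0 < q) (f : LaurentSeries R)
    {k : ℤ} (hk : ¬ (q : ℤ) ∣ k) : (laurentExpand R q hq f).coeff k = 0 := by
  refine embDomain_of_notMem_range ?_
  rintro ⟨m, rfl⟩
  exact hk ⟨m, rfl⟩

lemma algebraMap_laurentSeries [CommRing R] (r : R) :
    algebraMap R (LaurentSeries R) r = C r := by
  rw [algebraMap_apply', PowerSeries.algebraMap_apply, Algebra.algebraMap_self_apply,
    ofPowerSeries_C]

lemma isUnit_single_neg_one_sub_single_one [CommRing R] [Nontrivial R] (u : R) :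
    IsUnit (single (-1) 1 - single 1 u : LaurentSeries R) := by
  have hs : IsUnit (single (-1) 1 : LaurentSeries R) :=
    .of_mul_eq_one (single 1 1) (by simp [single_mul_single])
  have ht : IsUnit (1 - single 2 u : LaurentSeries R) := by
    apply isUnit_of_orderTop_pos
    rw [sub_sub_cancel_left, orderTop_neg]
    refine lt_of_lt_of_le ?_ orderTop_single_le
    exact_mod_cast (two_pos : (0 : ℤ) < 2)
  have h := hs.mul ht
  rw [mul_sub, mul_one, single_mul_single, one_mul] at h
  exact h

variable [CommRing R] [CommRing A] [Algebra R A]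

section Monomials

variable {x y z : A} {u : R}

/-- The monomial `x ^ k` for `k ≥ 0` and `y ^ (-k)` for `k ≤ 0`. -/
def nodalMonomial (x y : A) (k : ℤ) : A := x ^ k.toNat * y ^ (-k).toNat

lemma pow_mul_pow_mem_span_nodalMonomial (hxy : x * y = algebraMap R A u) (a b : ℕ) :
    x ^ a * y ^ b ∈ Submodule.span R (Set.range (nodalMonomial x y)) := by
  induction a generalizing b with
  | zero => exact Submodule.subset_span ⟨-b, by simp [nodalMonomial]⟩
  | succ a ih =>
    cases b with
    | zero =>
      have h : (-((a + 1 : ℕ) : ℤ)).toNat = 0 := by omega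
      exact Submodule.subset_span ⟨(a + 1 : ℕ), by rw [nodalMonomial, Int.toNat_natCast, h]⟩
    | succ b =>
      have h : x ^ (a + 1) * y ^ (b + 1) = u • (x ^ a * y ^ b) := by
        rw [Algebra.smul_def, ← hxy]; ring
      rw [h]
      exact Submodule.smul_mem _ _ (ih b)

lemma mul_mem_span_nodalMonomial (hxy : x * y = algebraMap R A u) {a b : A}
    (ha : a ∈ Submodule.span R (Set.range (nodalMonomial x y)))
    (hb : b ∈ Submodule.span R (Set.range (nodalMonomial x y))) :
    a * b ∈ Submodule.span R (Set.range (nodalMonomial x y)) := by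
  have h := Submodule.mul_mem_mul ha hb
  rw [Submodule.span_mul_span] at h
  refine Submodule.span_le.2 ?_ h
  rintro _ ⟨_, ⟨j, rfl⟩, _, ⟨k, rfl⟩, rfl⟩
  have h : nodalMonomial x y j * nodalMonomial x y k =
      x ^ (j.toNat + k.toNat) * y ^ ((-j).toNat + (-k).toNat) := by
    simp only [nodalMonomial]; ring
  change nodalMonomial x y j * nodalMonomial x y k ∈ _
  rw [h]
  exact pow_mul_pow_mem_span_nodalMonomial hxy _ _

lemma exists_pow_mul_mem_span_nodalMonomial (hxy : x * y = algebraMap R A u)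
    (hz : z * (x - y) = 1) (hgen : Algebra.adjoin R {x, y, z} = ⊤) (a : A) :
    ∃ N, ∀ M, N ≤ M →
      (x - y) ^ M * a ∈ Submodule.span R (Set.range (nodalMonomial x y)) := by
  set T := Submodule.span R (Set.range (nodalMonomial x y))
  have hx : x ∈ T := by simpa using pow_mul_pow_mem_span_nodalMonomial hxy 1 0
  have hy : y ∈ T := by simpa using pow_mul_pow_mem_span_nodalMonomial hxy 0 1
  have h1 : (1 : A) ∈ T := by simpa using pow_mul_pow_mem_span_nodalMonomial hxy 0 0
  have hpow : ∀ M, (x - y) ^ M ∈ T := fun M => by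
    induction M with
    | zero => simpa using h1
    | succ M ih => rw [pow_succ]; exact mul_mem_span_nodalMonomial hxy ih (sub_mem hx hy)
  have ha : a ∈ Algebra.adjoin R {x, y, z} := hgen ▸ Algebra.mem_top
  induction ha using Algebra.adjoin_induction with
  | mem a ha =>
    rcases ha with rfl | rfl | rfl
    · exact ⟨0, fun M _ => mul_mem_span_nodalMonomial hxy (hpow M) hx⟩
    · exact ⟨0, fun M _ => mul_mem_span_nodalMonomial hxy (hpow M) hy⟩
    · refine ⟨1, fun M hM => ?_⟩
      obtain ⟨M, rfl⟩ := Nat.exists_eq_add_of_le' hM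
      rw [pow_succ, mul_assoc, mul_comm (x - y), hz, mul_one]
      exact hpow M
  | algebraMap r =>
    refine ⟨0, fun M _ => ?_⟩
    rw [mul_comm, ← Algebra.smul_def]
    exact Submodule.smul_mem _ _ (hpow M)
  | add a b _ _ ha hb =>
    obtain ⟨N₁, h₁⟩ := ha
    obtain ⟨N₂, h₂⟩ := hb
    refine ⟨max N₁ N₂, fun M hM => ?_⟩
    rw [mul_add]
    exact add_mem (h₁ M (le_of_max_le_left hM)) (h₂ M (le_of_max_le_right hM))
  | mul a b _ _ ha hb =>
    obtain ⟨N₁, h₁⟩ := ha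
    obtain ⟨N₂, h₂⟩ := hb
    refine ⟨N₁ + N₂, fun M hM => ?_⟩
    obtain ⟨M, rfl⟩ := Nat.exists_eq_add_of_le hM
    have h : (x - y) ^ (N₁ + N₂ + M) * (a * b) =
        ((x - y) ^ N₁ * a) * ((x - y) ^ (N₂ + M) * b) := by ring
    rw [h]
    exact mul_mem_span_nodalMonomial hxy (h₁ _ le_rfl) (h₂ _ (Nat.le_add_right _ _))

end Monomials

variable [Fact p.Prime] [CharP R p]

/-- The additive map `(c_k) ↦ ∑ e_k ⊗ c_k` to a Frobenius twist of `A` attached to a family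
`(e_k)` in `A`. -/
noncomputable def tmulSum (p i : ℕ) [Fact p.Prime] [CharP R p] (e : ℤ → A) :
    (ℤ →₀ R) →+ A ⊗[R] Tw p i R :=
  Finsupp.liftAddHom fun k =>
    (TensorProduct.mk R A (Tw p i R) (e k)).toAddMonoidHom.comp
      (twCast p i R).toAddEquiv.toAddMonoidHom

lemma tmulSum_single (e : ℤ → A) (k : ℤ) (r : R) :
    tmulSum p i e (Finsupp.single k r) = e k ⊗ₜ[R] twCast p i R r := by
  simp [tmulSum]

lemma tmul_mem_range_tmulSum (e : ℤ → A) {t : A} (ht : t ∈ Submodule.span R (Set.range e))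
    (v : Tw p i R) : t ⊗ₜ[R] v ∈ (tmulSum p i e : (ℤ →₀ R) →+ _).range := by
  induction ht using Submodule.span_induction generalizing v with
  | mem t ht =>
    obtain ⟨k, rfl⟩ := ht
    exact ⟨Finsupp.single k ((twCast p i R).symm v), by simp [tmulSum_single]⟩
  | zero => rw [TensorProduct.zero_tmul]; exact zero_mem _
  | add s t _ _ hs ht => rw [TensorProduct.add_tmul]; exact add_mem (hs v) (ht v)
  | smul r t _ ht => rw [TensorProduct.smul_tmul]; exact ht _

lemma exists_pow_tmul_mul_mem_range_tmulSum {x y z : A} {u : R}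
    (hxy : x * y = algebraMap R A u) (hz : z * (x - y) = 1)
    (hgen : Algebra.adjoin R {x, y, z} = ⊤) (w : A ⊗[R] Tw p i R) :
    ∃ N, ∀ M, N ≤ M → ((x - y) ^ M) ⊗ₜ[R] (1 : Tw p i R) * w ∈
      (tmulSum p i (nodalMonomial x y) : (ℤ →₀ R) →+ _).range := by
  induction w using TensorProduct.induction_on with
  | zero => exact ⟨0, fun M _ => by rw [mul_zero]; exact zero_mem _⟩
  | tmul a v =>
    obtain ⟨N, hN⟩ := exists_pow_mul_mem_span_nodalMonomial hxy hz hgen a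
    refine ⟨N, fun M hM => ?_⟩
    rw [Algebra.TensorProduct.tmul_mul_tmul, one_mul]
    exact tmul_mem_range_tmulSum _ (hN M hM) v
  | add a b ha hb =>
    obtain ⟨N₁, h₁⟩ := ha
    obtain ⟨N₂, h₂⟩ := hb
    refine ⟨max N₁ N₂, fun M hM => ?_⟩
    rw [mul_add]
    exact add_mem (h₁ M (le_of_max_le_left hM)) (h₂ M (le_of_max_le_right hM))

variable [CharP A p]

/-- The isomorphism `A ⊗ R → A` for the zeroth Frobenius twist. -/
noncomputable def twZeroHom (p : ℕ) (R A : Type u) [CommRing R] [CommRing A] [Algebra R A]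
    [Fact p.Prime] [CharP R p] : A ⊗[R] Tw p 0 R →+* A :=
  (Algebra.TensorProduct.lift (AlgHom.id R A)
    ({ (algebraMap R A).comp (twCast p 0 R).symm.toRingHom with
        commutes' := fun r => by simp [tw_algebraMap_apply] } : Tw p 0 R →ₐ[R] A)
    (fun _ _ => Commute.all _ _)).toRingHom

/-- The map `A^{p^i/R} → A`, `a ⊗ r ↦ a ^ p ^ i * r`. -/
noncomputable def twistHom (p : ℕ) (R A : Type u) [CommRing R] [CommRing A] [Algebra R A]
    [Fact p.Prime] [CharP R p] [CharP A p] : ∀ i, A ⊗[R] Tw p i R →+* A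
  | 0 => twZeroHom p R A
  | i + 1 => (twistHom p R A i).comp (transRingHom p i R A)

lemma twistHom_tmul (a : A) (v : Tw p i R) :
    twistHom p R A i (a ⊗ₜ[R] v) = a ^ p ^ i * algebraMap R A ((twCast p i R).symm v) := by
  induction i generalizing a with
  | zero => simp [twistHom, twZeroHom]
  | succ i ih =>
    change twistHom p R A i (transAddHom p i R A (a ⊗ₜ[R] v)) = _
    rw [transAddHom_tmul, ih, RingEquiv.symm_apply_apply, ← pow_mul, ← pow_succ']

section Laurent

variable {x y z : A} {u : R} {φ : A →ₐ[R] LaurentSeries R}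

lemma map_nodalMonomial (hφx : φ x = single (-1) 1) (hφy : φ y = single 1 u) (k : ℤ) :
    φ (nodalMonomial x y k) = single (-k) (u ^ (-k).toNat) := by
  rw [nodalMonomial, map_mul, map_pow, map_pow, hφx, hφy, single_pow, single_pow,
    single_mul_single, one_pow, one_mul]
  congr 2
  simp
  omega

lemma coeff_map_twistHom_tmulSum (hφx : φ x = single (-1) 1) (hφy : φ y = single 1 u)
    (c : ℤ →₀ R) (j : ℤ) :
    (φ (twistHom p R A i (tmulSum p i (nodalMonomial x y) c))).coeff (p ^ i * -j) =
      (u ^ (-j).toNat) ^ p ^ i * c j := by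
  have hp : (p : ℤ) ^ i ≠ 0 := pow_ne_zero _ (by exact_mod_cast (Fact.out : p.Prime).ne_zero)
  induction c using Finsupp.induction_linear with
  | zero => simp
  | add f g hf hg => simp only [map_add, coeff_add, hf, hg, Finsupp.add_apply, mul_add]
  | single k r =>
    rw [tmulSum_single, twistHom_tmul, RingEquiv.symm_apply_apply, map_mul, map_pow,
      map_nodalMonomial hφx hφy, AlgHom.commutes, single_pow,
      algebraMap_laurentSeries, C_apply,
      single_mul_single, add_zero]
    by_cases hjk : j = k
    · subst hjk
      rw [Finsupp.single_eq_same, nsmul_eq_mul, Nat.cast_pow, coeff_single_same]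
    · rw [Finsupp.single_eq_of_ne hjk, mul_zero, coeff_single_of_ne]
      rw [nsmul_eq_mul, Nat.cast_pow]
      intro h
      exact hjk (neg_injective (mul_left_cancel₀ hp h))

lemma map_twistHom_injective [IsDomain R] (hu : u ≠ 0) (hxy : x * y = algebraMap R A u)
    (hz : z * (x - y) = 1) (hgen : Algebra.adjoin R {x, y, z} = ⊤)
    (hφx : φ x = single (-1) 1) (hφy : φ y = single 1 u) (i : ℕ) :
    Function.Injective fun w => φ (twistHom p R A i w) := by
  refine (injective_iff_map_eq_zero ((φ : A →+* LaurentSeries R).comp (twistHom p R A i))).2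
    fun w hw => ?_
  replace hw : φ (twistHom p R A i w) = 0 := hw
  obtain ⟨N, hN⟩ := exists_pow_tmul_mul_mem_range_tmulSum hxy hz hgen w
  obtain ⟨c, hc⟩ := hN N le_rfl
  have hc0 : c = 0 := by
    ext j
    have h := coeff_map_twistHom_tmulSum (p := p) (i := i) hφx hφy c j
    rw [hc, map_mul, map_mul, hw, mul_zero, coeff_zero] at h
    exact (mul_eq_zero.1 h.symm).resolve_left (pow_ne_zero _ (pow_ne_zero _ hu))
  rw [hc0, map_zero] at hc
  have h1 : (z ^ N) ⊗ₜ[R] (1 : Tw p i R) * ((x - y) ^ N) ⊗ₜ[R] (1 : Tw p i R) = 1 := by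
    rw [Algebra.TensorProduct.tmul_mul_tmul, ← mul_pow, hz, one_pow, one_mul,
      Algebra.TensorProduct.one_def]
  rw [← one_mul w, ← h1, mul_assoc, ← hc, mul_zero]

lemma map_pow_mem_range_laurentExpand [Nontrivial R] (hz : z * (x - y) = 1)
    (hgen : Algebra.adjoin R {x, y, z} = ⊤)
    (hφx : φ x = single (-1) 1) (hφy : φ y = single 1 u) (i : ℕ) (hq : 0 < p ^ i) (a : A) :
    φ (a ^ p ^ i) ∈ (laurentExpand R (p ^ i) hq).range := by
  have hX : φ (x ^ p ^ i) = laurentExpand R (p ^ i) hq (single (-1) 1) := by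
    rw [map_pow, hφx, laurentExpand_single, single_pow, one_pow, nsmul_eq_mul]
  have hY : φ (y ^ p ^ i) = laurentExpand R (p ^ i) hq (single 1 (u ^ p ^ i)) := by
    rw [map_pow, hφy, laurentExpand_single, single_pow, nsmul_eq_mul]
  have ha : a ∈ Algebra.adjoin R {x, y, z} := hgen ▸ Algebra.mem_top
  induction ha using Algebra.adjoin_induction with
  | mem a ha =>
    rcases ha with rfl | rfl | rfl
    · exact ⟨_, hX.symm⟩
    · exact ⟨_, hY.symm⟩
    · obtain ⟨s, hs⟩ := (isUnit_single_neg_one_sub_single_one (u ^ p ^ i)).exists_left_inv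
      refine ⟨s, ?_⟩
      have h1 : φ (a ^ p ^ i) * laurentExpand R (p ^ i) hq
          (single (-1) 1 - single 1 (u ^ p ^ i)) = 1 := by
        rw [map_sub, ← hX, ← hY, ← map_sub, ← sub_pow_char_pow, ← map_mul, ← mul_pow, hz,
          one_pow, map_one]
      have h2 := congrArg (laurentExpand R (p ^ i) hq) hs
      rw [map_mul, map_one (laurentExpand R (p ^ i) hq)] at h2
      rw [← mul_one (laurentExpand R (p ^ i) hq s), ← h1, mul_left_comm, h2, mul_one]
  | algebraMap r =>
    refine ⟨C (r ^ p ^ i), ?_⟩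
    rw [← map_pow, AlgHom.commutes, algebraMap_laurentSeries]
    exact embDomainRingHom_C
  | add a b _ _ ha hb => rw [add_pow_char_pow, map_add]; exact add_mem ha hb
  | mul a b _ _ ha hb => rw [mul_pow, map_mul]; exact mul_mem ha hb

lemma map_twistHom_mem_range_laurentExpand [Nontrivial R] (hz : z * (x - y) = 1)
    (hgen : Algebra.adjoin R {x, y, z} = ⊤)
    (hφx : φ x = single (-1) 1) (hφy : φ y = single 1 u) (hq : 0 < p ^ i)
    (w : A ⊗[R] Tw p i R) :
    φ (twistHom p R A i w) ∈ (laurentExpand R (p ^ i) hq).range := by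
  induction w using TensorProduct.induction_on with
  | zero => simp only [map_zero]; exact zero_mem _
  | tmul a v =>
    rw [twistHom_tmul, map_mul]
    refine mul_mem (map_pow_mem_range_laurentExpand hz hgen hφx hφy i hq a) ?_
    rw [AlgHom.commutes, algebraMap_laurentSeries]
    exact ⟨_, embDomainRingHom_C⟩
  | add a b ha hb => rw [map_add, map_add]; exact add_mem ha hb

lemma algebraMap_prePerfection_bijective_of_laurent [IsDomain R] (hu : u ≠ 0)
    (hxy : x * y = algebraMap R A u) (hz : z * (x - y) = 1)
    (hgen : Algebra.adjoin R {x, y, z} = ⊤)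
    (hφx : φ x = single (-1) 1) (hφy : φ y = single 1 u) :
    Function.Bijective (algebraMap R (prePerfection p R A)) := by
  have hconst : ∀ i (r : R),
      φ (twistHom p R A i ((1 : A) ⊗ₜ[R] twCast p i R r)) = C r := fun i r => by
    rw [twistHom_tmul, one_pow, one_mul, RingEquiv.symm_apply_apply, AlgHom.commutes,
      algebraMap_laurentSeries]
  constructor
  · intro r s hrs
    have h : (1 : A) ⊗ₜ[R] twCast p 0 R r = (1 : A) ⊗ₜ[R] twCast p 0 R s :=
      congrFun (congrArg Subtype.val hrs) 0
    apply C_injective (Γ := ℤ)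
    rw [← hconst 0 r, ← hconst 0 s, h]
  · rintro ⟨f, hf⟩
    have hstep : ∀ i, φ (twistHom p R A i (f i)) = φ (twistHom p R A 0 (f 0)) := fun i => by
      induction i with
      | zero => rfl
      | succ i ih =>
        rw [← ih, ← hf i]
        rfl
    set g : LaurentSeries R := φ (twistHom p R A 0 (f 0))
    have hg : g = C (g.coeff 0) := by
      ext k
      by_cases hk : k = 0
      · subst hk
        exact (coeff_single_same 0 (g.coeff 0)).symm
      · rw [C_apply, coeff_single_of_ne hk]
        have hp : 1 < p := (Fact.out : p.Prime).one_lt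
        have hq : 0 < p ^ k.natAbs := pow_pos (by omega) _
        obtain ⟨h, hh⟩ := map_twistHom_mem_range_laurentExpand (i := k.natAbs)
          hz hgen hφx hφy hq (f k.natAbs)
        rw [← hstep k.natAbs, ← hh]
        refine coeff_laurentExpand_of_not_dvd hq h fun hdvd => ?_
        have h1 : p ^ k.natAbs ≤ k.natAbs :=
          Nat.le_of_dvd (Int.natAbs_pos.2 hk) (Int.natCast_dvd.1 hdvd)
        exact absurd (Nat.lt_pow_self hp) (not_lt.2 h1)
    refine ⟨g.coeff 0, Subtype.ext (funext fun i => ?_)⟩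
    refine map_twistHom_injective (p := p) hu hxy hz hgen hφx hφy i ?_
    change φ (twistHom p R A i ((1 : A) ⊗ₜ[R] twCast p i R (g.coeff 0))) =
      φ (twistHom p R A i (f i))
    rw [hconst, hstep, ← hg]

end Laurent

/-- For `u ≠ 0` in a domain `R`, the preperfection of `R[x, y, (x - y)⁻¹] / (xy - u)` over `R`
is `R`. -/
lemma algebraMap_prePerfection_nodal_bijective [IsDomain R] {u : R} (hu : u ≠ 0)
    {I : Ideal (MvPolynomial (Fin 3) R)}
    (hI : I = Ideal.span {
      MvPolynomial.X 0 * MvPolynomial.X 1 - MvPolynomial.C u,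
      MvPolynomial.X 2 * (MvPolynomial.X 0 - MvPolynomial.X 1) - 1})
    [CharP (MvPolynomial (Fin 3) R ⧸ I) p] :
    Function.Bijective (algebraMap R (prePerfection p R (MvPolynomial (Fin 3) R ⧸ I))) := by
  obtain ⟨s, hs⟩ := (isUnit_single_neg_one_sub_single_one u).exists_left_inv
  let ψ : MvPolynomial (Fin 3) R →ₐ[R] LaurentSeries R :=
    MvPolynomial.aeval ![single (-1) 1, single 1 u, s]
  have hψ : ∀ a ∈ I, ψ a = 0 := by
    intro a ha
    rw [hI] at ha
    refine (Ideal.span_le (I := RingHom.ker ψ)).2 ?_ ha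
    rintro _ (rfl | rfl)
    · simp [ψ, single_mul_single, algebraMap_laurentSeries]
    · simp only [SetLike.mem_coe, RingHom.mem_ker, map_sub, map_mul, map_one ψ, ψ,
        MvPolynomial.aeval_X]
      exact sub_eq_zero.2 hs
  let x : Fin 3 → MvPolynomial (Fin 3) R ⧸ I := fun j => Ideal.Quotient.mk I (MvPolynomial.X j)
  refine algebraMap_prePerfection_bijective_of_laurent (x := x 0) (y := x 1) (z := x 2)
    (φ := Ideal.Quotient.liftₐ I ψ hψ) hu ?_ ?_ ?_ ?_ ?_
  · exact Ideal.Quotient.eq.2 (hI ▸ Ideal.subset_span (Or.inl rfl))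
  · exact Ideal.Quotient.eq.2 (hI ▸ Ideal.subset_span (Or.inr rfl))
  · have hr : ({x 0, x 1, x 2} : Set (MvPolynomial (Fin 3) R ⧸ I)) =
        Ideal.Quotient.mkₐ R I '' Set.range MvPolynomial.X := by
      ext a
      simp [Fin.exists_fin_succ, x, eq_comm]
    rw [hr, ← AlgHom.map_adjoin, MvPolynomial.adjoin_range_X, Algebra.map_top, AlgHom.range_eq_top]
    exact Ideal.Quotient.mkₐ_surjective _ _
  · change ψ (MvPolynomial.X 0) = _
    simp [ψ]
  · change ψ (MvPolynomial.X 1) = _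
    simp [ψ]

end NodalDegeneration

/-- **The preperfection of `A = F_p[[u]][x,y,(x-y)⁻¹]/(xy - u)` over
`R = F_p[[u]]` is `R` itself**: the structure map
`R → A^{p^∞/R} = lim_i A^{p^i/R}` is an isomorphism. -/
theorem preperfection_nodal_degeneration_eq_base (p : ℕ) [Fact p.Prime]
    [CharP (R14 p) p] [CharP (A14 p) p] :
    Function.Bijective (algebraMap (R14 p) (↥(prePerfection p (R14 p) (A14 p)))) := by
  exact algebraMap_prePerfection_nodal_bijective PowerSeries.X_ne_zero rfl
end
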